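/- arXiv:2507.15080 — 2 statements merged into one kernel-verified Lean document; each statement's English description precedes it below -/
import Mathlib

section
/- The fair coalition number of the Petersen graph equals 4. -/
open SimpleGraph

/-- `D` is a fair dominating set of `G`: it is a dominating set and there is some
`k ≥ 1` such that every vertex outside `D` has exactly `k` neighbors in `D`. -/
def IsFairDomSet {V : Type*} (G : SimpleGraph V) (D : Set V) : Prop :=
  (∀ v ∉ D, ∃ u ∈ D, G.Adj v u) ∧
  ∃ k : ℕ, 1 ≤ k ∧ ∀ v ∉ D, (G.neighborSet v ∩ D).ncard = k

/-- A fair coalition partition of `G`: a partition of the vertex set into nonempty parts,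
each of which is either a singleton fair dominating set, or is not a fair dominating set
but forms a fair coalition with another part that is not a fair dominating set. -/
def IsFairCoalitionPartition {V : Type*} (G : SimpleGraph V) (P : Finset (Set V)) : Prop :=
  (∀ A ∈ P, A.Nonempty) ∧
  (P : Set (Set V)).PairwiseDisjoint id ∧
  ⋃₀ (P : Set (Set V)) = Set.univ ∧
  ∀ A ∈ P, ((∃ v, A = {v}) ∧ IsFairDomSet G A) ∨
    (¬ IsFairDomSet G A ∧ ∃ B ∈ P, B ≠ A ∧ ¬ IsFairDomSet G B ∧ IsFairDomSet G (A ∪ B))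

/-- The fair coalition number of `G`: the maximum number of parts in a fair
coalition partition of `G`. -/
noncomputable def fairCoalitionNumber {V : Type*} (G : SimpleGraph V) : ℕ :=
  sSup {n | ∃ P : Finset (Set V), IsFairCoalitionPartition G P ∧ P.card = n}

/-- The Petersen graph: vertices are the 2-element subsets of a 5-element set,
adjacent iff the corresponding subsets are disjoint. -/
def petersenGraph : SimpleGraph {s : Finset (Fin 5) // s.card = 2} :=
  SimpleGraph.fromRel (fun a b => Disjoint a.1 b.1)

namespace PetersenFair

/-- Vertices of the Petersen graph. -/
abbrev PV := {s : Finset (Fin 5) // s.card = 2}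

/-- Enumeration of the vertices. -/
def e : Fin 10 → PV :=
  ![⟨{0, 1}, rfl⟩, ⟨{0, 2}, rfl⟩, ⟨{0, 3}, rfl⟩, ⟨{0, 4}, rfl⟩, ⟨{1, 2}, rfl⟩,
    ⟨{1, 3}, rfl⟩, ⟨{1, 4}, rfl⟩, ⟨{2, 3}, rfl⟩, ⟨{2, 4}, rfl⟩, ⟨{3, 4}, rfl⟩]

/-- The three neighbours of every vertex. -/
def nb : Fin 10 → Fin 3 → Fin 10 :=
  ![![7, 8, 9], ![5, 6, 9], ![4, 6, 8], ![4, 5, 7], ![2, 3, 9],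
    ![1, 3, 8], ![1, 2, 7], ![0, 3, 6], ![0, 2, 5], ![0, 1, 4]]

theorem e_inj : Function.Injective e := by decide +kernel

theorem e_surj : Function.Surjective e := by decide +kernel

theorem adj_iff (i j : Fin 10) :
    petersenGraph.Adj (e i) (e j) ↔ (j = nb i 0 ∨ j = nb i 1 ∨ j = nb i 2) := by
  unfold petersenGraph
  rw [SimpleGraph.fromRel_adj]
  revert i j
  decide +kernel

theorem nb_ne (i : Fin 10) : nb i 0 ≠ nb i 1 ∧ nb i 0 ≠ nb i 2 ∧ nb i 1 ≠ nb i 2 := by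
  revert i
  decide +kernel

theorem nbhd (i : Fin 10) :
    petersenGraph.neighborSet (e i) = {e (nb i 0), e (nb i 1), e (nb i 2)} := by
  ext v
  obtain ⟨j, rfl⟩ := e_surj v
  simp only [SimpleGraph.mem_neighborSet, adj_iff, Set.mem_insert_iff, Set.mem_singleton_iff,
    e_inj.eq_iff]

/-- Number of neighbours of `i` in the set with bit mask `m`. -/
def cnt (m : ℕ) (i : Fin 10) : ℕ :=
  (m.testBit (nb i 0)).toNat + (m.testBit (nb i 1)).toNat + (m.testBit (nb i 2)).toNat

/-- Bit mask of a set. -/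
noncomputable def mask (D : Set PV) : ℕ := by
  classical exact Nat.ofBits (fun i : Fin 10 => decide (e i ∈ D))

theorem mask_lt (D : Set PV) : mask D < 1024 := by
  unfold mask
  exact Nat.ofBits_lt_two_pow _

theorem testBit_mask (D : Set PV) (i : Fin 10) : (mask D).testBit i = true ↔ e i ∈ D := by
  unfold mask
  rw [Nat.testBit_ofBits_lt _ _ i.2]
  simp

theorem testBit_mask_ge (D : Set PV) (i : ℕ) (h : 10 ≤ i) : (mask D).testBit i = false := by
  unfold mask
  exact Nat.testBit_ofBits_ge _ _ h

theorem mask_ext {m : ℕ} (hm : m < 1024) {D : Set PV}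
    (h : ∀ i : Fin 10, m.testBit i = true ↔ e i ∈ D) : mask D = m := by
  apply Nat.eq_of_testBit_eq
  intro i
  by_cases hi : i < 10
  · rw [Bool.eq_iff_iff, testBit_mask D ⟨i, hi⟩, ← h ⟨i, hi⟩]
  · rw [testBit_mask_ge D i (by omega), Nat.testBit_lt_two_pow]
    exact lt_of_lt_of_le hm (show 2 ^ 10 ≤ 2 ^ i from Nat.pow_le_pow_right (by norm_num) (by omega))

theorem mask_inter (A B : Set PV) : mask (A ∩ B) = mask A &&& mask B := by
  apply mask_ext
  · exact lt_of_le_of_lt Nat.and_le_left (mask_lt A)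
  · intro i
    simp only [Nat.testBit_and, Bool.and_eq_true, testBit_mask, Set.mem_inter_iff]

theorem mask_union (A B : Set PV) : mask (A ∪ B) = mask A ||| mask B := by
  apply mask_ext
  · exact Nat.or_lt_two_pow (n := 10) (mask_lt A) (mask_lt B)
  · intro i
    simp only [Nat.testBit_or, Bool.or_eq_true, testBit_mask, Set.mem_union]

theorem mask_empty : mask ∅ = 0 := by
  apply mask_ext (by norm_num)
  simp

theorem mask_inj {A B : Set PV} (h : mask A = mask B) : A = B := by
  ext v
  obtain ⟨i, rfl⟩ := e_surj v
  rw [← testBit_mask, ← testBit_mask, h]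

theorem ncard_eq (D : Set PV) (i : Fin 10) :
    (petersenGraph.neighborSet (e i) ∩ D).ncard = cnt (mask D) i := by
  classical
  have hne := nb_ne i
  have h01 : e (nb i 0) ≠ e (nb i 1) := fun h => hne.1 (e_inj h)
  have h02 : e (nb i 0) ≠ e (nb i 2) := fun h => hne.2.1 (e_inj h)
  have h12 : e (nb i 1) ≠ e (nb i 2) := fun h => hne.2.2 (e_inj h)
  have key : ∀ j, ((mask D).testBit (j : Fin 10)).toNat = if e j ∈ D then 1 else 0 := by
    intro j
    have := testBit_mask D j
    by_cases h : e j ∈ D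
    · simp [h, this.2 h]
    · have h2 : (mask D).testBit j = false := by
        rw [← Bool.not_eq_true, this]; exact h
      simp [h, h2]
  rw [nbhd, cnt, key, key, key]
  have : (({e (nb i 0), e (nb i 1), e (nb i 2)} : Set PV) ∩ D)
      = ((({e (nb i 0), e (nb i 1), e (nb i 2)} : Finset PV).filter (· ∈ D) : Finset PV) : Set PV) := by
    ext v
    simp
  rw [this, Set.ncard_coe_finset, Finset.card_filter, Finset.sum_insert (by simp [h01, h02]),
    Finset.sum_insert (by simp [h12]), Finset.sum_singleton, add_assoc]

/-- Indices of vertices. -/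
def idx : List (Fin 10) := [0, 1, 2, 3, 4, 5, 6, 7, 8, 9]

/-- Boolean fairness test for bit masks. -/
def fairB (m : ℕ) : Bool :=
  idx.all fun u => m.testBit u ||
    (Nat.ble 1 (cnt m u) && idx.all fun v => m.testBit v || Nat.beq (cnt m u) (cnt m v))

theorem mem_idx (i : Fin 10) : i ∈ idx := by
  revert i
  decide

theorem fairB_iff (m : ℕ) : fairB m = true ↔ ∀ u : Fin 10, ¬ m.testBit u = true →
    (1 ≤ cnt m u ∧ ∀ v : Fin 10, ¬ m.testBit v = true → cnt m u = cnt m v) := by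
  simp only [fairB, List.all_eq_true, mem_idx, forall_true_left, Bool.or_eq_true,
    Bool.and_eq_true, Nat.ble_eq, Nat.beq_eq, or_iff_not_imp_left]

theorem fair_iff (D : Set PV) : IsFairDomSet petersenGraph D ↔ fairB (mask D) = true := by
  rw [fairB_iff]
  simp only [testBit_mask]
  constructor
  · rintro ⟨_, k, hk, h⟩ u hu
    have := h _ hu
    rw [ncard_eq] at this
    refine ⟨by omega, fun v hv => ?_⟩
    have h2 := h _ hv
    rw [ncard_eq] at h2
    omega
  · intro h
    constructor
    · intro v hv
      obtain ⟨i, rfl⟩ := e_surj v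
      have h1 := (h i hv).1
      rw [← ncard_eq] at h1
      obtain ⟨u, hu⟩ := Set.nonempty_of_ncard_ne_zero (s := petersenGraph.neighborSet (e i) ∩ D)
        (by omega)
      exact ⟨u, hu.2, hu.1⟩
    · by_cases hD : ∃ i, e i ∉ D
      · obtain ⟨i, hi⟩ := hD
        refine ⟨cnt (mask D) i, (h i hi).1, fun v hv => ?_⟩
        obtain ⟨j, rfl⟩ := e_surj v
        rw [ncard_eq, (h i hi).2 j hv]
      · refine ⟨1, le_rfl, fun v hv => ?_⟩
        obtain ⟨j, rfl⟩ := e_surj v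
        exact absurd ⟨j, hv⟩ hD

/-- All masks of fair dominating sets. -/
def fairs : List ℕ := (List.range 1024).filter fairB

theorem mem_fairs {D : Set PV} (h : IsFairDomSet petersenGraph D) : mask D ∈ fairs := by
  rw [fairs, List.mem_filter, List.mem_range]
  exact ⟨mask_lt D, (fair_iff D).1 h⟩

/-- Two disjoint fair dominating sets cover everything. -/
def check1 (F : List ℕ) : Bool :=
  F.all fun f => F.all fun g => !(Nat.beq (f &&& g) 0) || Nat.beq (f ||| g) 1023

/-- Masks of the list meeting `f` exactly in `a`. -/
def sub (F : List ℕ) (f a : ℕ) : List ℕ := F.filter fun g => Nat.beq (f &&& g) a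

/-- At least three vertices are missing. -/
def misses3 (m : ℕ) : Bool := Nat.ble 3 (idx.filter fun i : Fin 10 => !m.testBit i).length

theorem misses3_of {m : ℕ} {i j k : Fin 10} (hij : i ≠ j) (hik : i ≠ k) (hjk : j ≠ k)
    (hi : m.testBit i = false) (hj : m.testBit j = false) (hk : m.testBit k = false) :
    misses3 m = true := by
  rw [misses3, Nat.ble_eq]
  have hnd : [i, j, k].Nodup := by simp [hij, hik, hjk]
  have hsub : [i, j, k] ⊆ idx.filter fun i : Fin 10 => !m.testBit i := by
    intro x hx
    simp only [List.mem_cons, List.not_mem_nil, or_false] at hx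
    rw [List.mem_filter]
    rcases hx with rfl | rfl | rfl <;> simp [mem_idx, *]
  simpa using (List.subperm_of_subset hnd hsub).length_le

/-- No sunflower with four petals whose kernel is not fair. -/
def check2 (F : List ℕ) : Bool :=
  (List.range 1024).all fun a => fairB a ||
    ((F.filter fun f => Nat.beq (f &&& a) a) |> fun L => L.all fun f =>
      (sub L f a) |> fun L2 => L2.all fun g =>
      (sub L2 g a) |> fun L3 => L3.all fun h =>
      (sub L3 h a).isEmpty)

theorem check1_true : check1 fairs = true := by decide +kernel

theorem check2_true : check2 (fairs.filter misses3) = true := by decide +kernel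

theorem fact1 {A B : Set PV} (hA : IsFairDomSet petersenGraph A)
    (hB : IsFairDomSet petersenGraph B) (h : A ∩ B = ∅) (v : PV) : v ∈ A ∪ B := by
  have h1 := check1_true
  simp only [check1, List.all_eq_true] at h1
  have h2 := h1 _ (mem_fairs hA) _ (mem_fairs hB)
  rw [← mask_inter, ← mask_union, h, mask_empty] at h2
  have h3 : mask (A ∪ B) = 1023 := by simpa using h2
  obtain ⟨i, rfl⟩ := e_surj v
  rw [← testBit_mask, h3]
  revert i
  decide

theorem mem_big {A B C D E : Set PV} (hF : IsFairDomSet petersenGraph (A ∪ B))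
    (hC : C.Nonempty) (hD : D.Nonempty) (hE : E.Nonempty)
    (hAC : Disjoint A C) (hAD : Disjoint A D) (hAE : Disjoint A E)
    (hBC : Disjoint B C) (hBD : Disjoint B D) (hBE : Disjoint B E)
    (hCD : Disjoint C D) (hCE : Disjoint C E) (hDE : Disjoint D E) :
    mask (A ∪ B) ∈ fairs.filter misses3 := by
  rw [List.mem_filter]
  refine ⟨mem_fairs hF, ?_⟩
  obtain ⟨c, hc⟩ := hC
  obtain ⟨d, hd⟩ := hD
  obtain ⟨x, hx⟩ := hE
  obtain ⟨i, rfl⟩ := e_surj c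
  obtain ⟨j, rfl⟩ := e_surj d
  obtain ⟨k, rfl⟩ := e_surj x
  rw [Set.disjoint_left] at *
  apply misses3_of (i := i) (j := j) (k := k)
  · rintro rfl; exact hCD hc hd
  · rintro rfl; exact hCE hc hx
  · rintro rfl; exact hDE hd hx
  · rw [← Bool.not_eq_true, testBit_mask]
    rintro (h | h)
    exacts [hAC h hc, hBC h hc]
  · rw [← Bool.not_eq_true, testBit_mask]
    rintro (h | h)
    exacts [hAD h hd, hBD h hd]
  · rw [← Bool.not_eq_true, testBit_mask]
    rintro (h | h)
    exacts [hAE h hx, hBE h hx]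

theorem inter_eq {A B C : Set PV} (h : Disjoint B C) :
    mask (A ∪ B) &&& mask (A ∪ C) = mask A := by
  rw [← mask_inter, ← Set.union_inter_distrib_left, Set.disjoint_iff_inter_eq_empty.1 h,
    Set.union_empty]

theorem fact2 {A B C D E : Set PV} (hA : ¬ IsFairDomSet petersenGraph A)
    (fB : IsFairDomSet petersenGraph (A ∪ B)) (fC : IsFairDomSet petersenGraph (A ∪ C))
    (fD : IsFairDomSet petersenGraph (A ∪ D)) (fE : IsFairDomSet petersenGraph (A ∪ E))
    (nB : B.Nonempty) (nC : C.Nonempty) (nD : D.Nonempty) (nE : E.Nonempty)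
    (hAB : Disjoint A B) (hAC : Disjoint A C) (hAD : Disjoint A D) (hAE : Disjoint A E)
    (hBC : Disjoint B C) (hBD : Disjoint B D) (hBE : Disjoint B E)
    (hCD : Disjoint C D) (hCE : Disjoint C E) (hDE : Disjoint D E) : False := by
  have mB := mem_big fB nC nD nE hAC hAD hAE hBC hBD hBE hCD hCE hDE
  have mC := mem_big fC nB nD nE hAB hAD hAE hBC.symm hCD hCE hBD hBE hDE
  have mD := mem_big fD nB nC nE hAB hAC hAE hBD.symm hCD.symm hDE hBC hBE hCE
  have mE := mem_big fE nB nC nD hAB hAC hAD hBE.symm hCE.symm hDE.symm hBC hBD hCD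
  have h1 := check2_true
  simp only [check2, List.all_eq_true] at h1
  have h2 := h1 (mask A) (List.mem_range.2 (mask_lt A))
  have hA' : fairB (mask A) = false := by
    rw [← Bool.not_eq_true, ← fair_iff]; exact hA
  simp only [hA', Bool.false_or, List.all_eq_true] at h2
  have base : ∀ X : Set PV, mask (A ∪ X) &&& mask A = mask A := by
    intro X
    rw [← mask_inter, Set.inter_eq_right.2 Set.subset_union_left]
  have h3 := h2 (mask (A ∪ B)) (by simp [List.mem_filter.1 mB, base])
    (mask (A ∪ C)) (by simp [sub, List.mem_filter.1 mC, base, inter_eq, *])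
    (mask (A ∪ D)) (by simp [sub, List.mem_filter.1 mD, base, inter_eq, *])
  rw [List.isEmpty_iff] at h3
  have h4 : mask (A ∪ E) ∈ ([] : List ℕ) := by
    rw [← h3]
    simp [sub, List.mem_filter.1 mE, base, inter_eq, *]
  simp at h4

theorem not_singleton_fair (v : PV) : ¬ IsFairDomSet petersenGraph {v} := by
  obtain ⟨i, rfl⟩ := e_surj v
  rw [fair_iff, mask_ext (m := 2 ^ (i : ℕ))]
  · revert i; decide +kernel
  · revert i; decide +kernel
  · intro j
    rw [Set.mem_singleton_iff, e_inj.eq_iff]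
    revert i j; decide +kernel

theorem upper {P : Finset (Set PV)} (hP : IsFairCoalitionPartition petersenGraph P) :
    P.card ≤ 4 := by
  classical
  obtain ⟨hne, hdisj, _, hco⟩ := hP
  by_contra! hcard
  have hd : ∀ A ∈ P, ∀ B ∈ P, A ≠ B → Disjoint A B := fun A hA B hB h => hdisj hA hB h
  have hpart : ∀ A ∈ P, ¬ IsFairDomSet petersenGraph A ∧
      ∃ B ∈ P, B ≠ A ∧ IsFairDomSet petersenGraph (A ∪ B) := by
    intro A hA
    rcases hco A hA with ⟨⟨v, rfl⟩, h⟩ | ⟨h, B, hB, hBA, _, hAB⟩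
    · exact absurd h (not_singleton_fair v)
    · exact ⟨h, B, hB, hBA, hAB⟩
  have pick : ∀ S : Finset (Set PV), S.card ≤ 4 → ∃ X ∈ P, X ∉ S := by
    intro S hS
    exact Finset.exists_mem_notMem_of_card_lt_card (by omega)
  have cross : ∀ A ∈ P, ∀ B ∈ P, ∀ C ∈ P, ∀ D ∈ P, A ≠ C → A ≠ D → B ≠ C → B ≠ D →
      IsFairDomSet petersenGraph (A ∪ B) → IsFairDomSet petersenGraph (C ∪ D) → False := by
    intro A hA B hB C hC D hD hAC hAD hBC hBD f1 f2
    obtain ⟨X, hX, hXS⟩ := pick {A, B, C, D} Finset.card_le_four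
    simp only [Finset.mem_insert, Finset.mem_singleton, not_or] at hXS
    obtain ⟨v, hv⟩ := hne X hX
    have hdis : (A ∪ B) ∩ (C ∪ D) = ∅ := by
      rw [← Set.disjoint_iff_inter_eq_empty, Set.disjoint_union_left, Set.disjoint_union_right,
        Set.disjoint_union_right]
      exact ⟨⟨hd _ hA _ hC hAC, hd _ hA _ hD hAD⟩, hd _ hB _ hC hBC, hd _ hB _ hD hBD⟩
    have no : ∀ Y ∈ P, X ≠ Y → v ∉ Y := fun Y hY h hvY =>
      Set.disjoint_left.1 (hd _ hX _ hY h) hv hvY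
    rcases fact1 f1 f2 hdis v with (h | h) | (h | h)
    · exact no A hA hXS.1 h
    · exact no B hB hXS.2.1 h
    · exact no C hC hXS.2.2.1 h
    · exact no D hD hXS.2.2.2 h
  -- a path on three parts yields a star
  have star : ∀ A ∈ P, ∀ B ∈ P, ∀ C ∈ P, A ≠ B → A ≠ C → B ≠ C →
      IsFairDomSet petersenGraph (A ∪ B) → IsFairDomSet petersenGraph (A ∪ C) → False := by
    intro A hA B hB C hC hAB hAC hBC fB fC
    have step : ∀ D ∈ P, D ≠ A → D ≠ B → D ≠ C → IsFairDomSet petersenGraph (A ∪ D) := by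
      intro D hD hDA hDB hDC
      obtain ⟨_, X, hX, hXD, f⟩ := hpart D hD
      by_cases hXA : X = A
      · subst hXA
        rwa [Set.union_comm]
      · exfalso
        by_cases hXB : X = B
        · subst hXB
          exact cross D hD X hX A hA C hC hDA hDC hXA hBC f fC
        · exact cross D hD X hX A hA B hB hDA hDB hXA hXB f fB
    obtain ⟨D, hD, hDS⟩ := pick {A, B, C} (Finset.card_le_three.trans (by norm_num))
    obtain ⟨E, hE, hES⟩ := pick {A, B, C, D} Finset.card_le_four
    simp only [Finset.mem_insert, Finset.mem_singleton, not_or] at hDS hES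
    obtain ⟨hDA, hDB, hDC⟩ := hDS
    obtain ⟨hEA, hEB, hEC, hED⟩ := hES
    exact fact2 (hpart A hA).1 fB fC (step D hD hDA hDB hDC) (step E hE hEA hEB hEC)
      (hne _ hB) (hne _ hC) (hne _ hD) (hne _ hE)
      (hd _ hA _ hB hAB) (hd _ hA _ hC hAC) (hd _ hA _ hD (Ne.symm hDA))
      (hd _ hA _ hE (Ne.symm hEA)) (hd _ hB _ hC hBC) (hd _ hB _ hD (Ne.symm hDB))
      (hd _ hB _ hE (Ne.symm hEB)) (hd _ hC _ hD (Ne.symm hDC)) (hd _ hC _ hE (Ne.symm hEC))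
      (hd _ hD _ hE (Ne.symm hED))
  obtain ⟨A, hA, _⟩ := pick ∅ (by simp)
  obtain ⟨_, B, hB, hBA, fB⟩ := hpart A hA
  obtain ⟨C, hC, hCS⟩ := pick {A, B} (Finset.card_le_two.trans (by norm_num))
  simp only [Finset.mem_insert, Finset.mem_singleton, not_or] at hCS
  obtain ⟨hCA, hCB⟩ := hCS
  obtain ⟨_, X, hX, hXC, fX⟩ := hpart C hC
  by_cases hXA : X = A
  · subst hXA
    exact star X hX B hB C hC (Ne.symm hBA) hXC (Ne.symm hCB) fB (by rwa [Set.union_comm])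
  by_cases hXB : X = B
  · subst hXB
    exact star X hX A hA C hC hXA hXC (Ne.symm hCA) (by rwa [Set.union_comm])
      (by rwa [Set.union_comm])
  exact cross A hA B hB C hC X hX (Ne.symm hCA) (Ne.symm hXA) (Ne.symm hCB) (Ne.symm hXB) fB fX

/-- The set with a given bit mask. -/
def toSet (m : ℕ) : Set PV := {v | ∃ i : Fin 10, e i = v ∧ m.testBit i = true}

theorem mem_toSet (m : ℕ) (i : Fin 10) : e i ∈ toSet m ↔ m.testBit i = true := by
  constructor
  · rintro ⟨j, hj, h⟩
    rwa [← e_inj hj]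
  · exact fun h => ⟨i, rfl, h⟩

theorem mask_toSet {m : ℕ} (hm : m < 1024) : mask (toSet m) = m :=
  mask_ext hm fun i => (mem_toSet m i).symm

theorem lower : ∃ P : Finset (Set PV), IsFairCoalitionPartition petersenGraph P ∧ P.card = 4 := by
  classical
  have inj : ∀ a b : ℕ, a < 1024 → b < 1024 → a ≠ b → toSet a ≠ toSet b := by
    intro a b ha hb hab h
    apply hab
    rw [← mask_toSet ha, h, mask_toSet hb]
  have ht : ∀ a : ℕ, a < 1024 → (IsFairDomSet petersenGraph (toSet a) ↔ fairB a = true) := by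
    intro a ha
    rw [fair_iff, mask_toSet ha]
  have hu : ∀ a b : ℕ, a < 1024 → b < 1024 →
      (IsFairDomSet petersenGraph (toSet a ∪ toSet b) ↔ fairB (a ||| b) = true) := by
    intro a b ha hb
    rw [fair_iff, mask_union, mask_toSet ha, mask_toSet hb]
  have hdj : ∀ a b : ℕ, a < 1024 → b < 1024 → a &&& b = 0 → Disjoint (toSet a) (toSet b) := by
    intro a b ha hb hab
    rw [Set.disjoint_iff_inter_eq_empty]
    apply mask_inj
    rw [mask_inter, mask_toSet ha, mask_toSet hb, hab, mask_empty]
  let L : Finset ℕ := {1, 2, 452, 568}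
  have hlt : ∀ a ∈ L, a < 1024 := by decide +kernel
  refine ⟨L.image toSet, ⟨?_, ?_, ?_, ?_⟩, ?_⟩
  · simp only [Finset.forall_mem_image]
    intro a ha
    have : ∀ a ∈ L, ∃ i : Fin 10, a.testBit i = true := by decide +kernel
    obtain ⟨i, hi⟩ := this a ha
    exact ⟨e i, (mem_toSet a i).2 hi⟩
  · intro A hA B hB hAB
    simp only [Finset.coe_image, Set.mem_image, Finset.mem_coe] at hA hB
    obtain ⟨a, ha, rfl⟩ := hA
    obtain ⟨b, hb, rfl⟩ := hB
    have hab : a ≠ b := fun h => hAB (by rw [h])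
    have : ∀ a ∈ L, ∀ b ∈ L, a ≠ b → a &&& b = 0 := by decide +kernel
    exact hdj a b (hlt a ha) (hlt b hb) (this a ha b hb hab)
  · rw [Set.eq_univ_iff_forall]
    intro v
    obtain ⟨i, rfl⟩ := e_surj v
    have : ∀ i : Fin 10, ∃ a ∈ L, a.testBit i = true := by decide +kernel
    obtain ⟨a, ha, h⟩ := this i
    exact ⟨toSet a, by simpa using ⟨a, ha, rfl⟩, (mem_toSet a i).2 h⟩
  · simp only [Finset.forall_mem_image]
    intro a ha
    right
    have h1 : ∀ a ∈ L, fairB a = false := by decide +kernel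
    have h2 : ∀ a ∈ L, ∃ b ∈ L, b ≠ a ∧ fairB (a ||| b) = true := by decide +kernel
    obtain ⟨b, hb, hba, hf⟩ := h2 a ha
    refine ⟨by rw [ht a (hlt a ha), h1 a ha]; simp, toSet b, Finset.mem_image_of_mem _ hb,
      inj b a (hlt b hb) (hlt a ha) hba, by rw [ht b (hlt b hb), h1 b hb]; simp,
      (hu a b (hlt a ha) (hlt b hb)).2 hf⟩
  · rw [Finset.card_image_of_injOn]
    · decide +kernel
    · intro a ha b hb h
      by_contra hab
      exact inj a b (hlt a ha) (hlt b hb) hab h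

end PetersenFair

theorem stmt_14 : fairCoalitionNumber petersenGraph = 4 := by
  have hg : IsGreatest {n | ∃ P : Finset (Set {s : Finset (Fin 5) // s.card = 2}),
      IsFairCoalitionPartition petersenGraph P ∧ P.card = n} 4 := by
    refine ⟨PetersenFair.lower, ?_⟩
    rintro n ⟨P, hP, rfl⟩
    exact PetersenFair.upper hP
  exact hg.csSup_eq
end

section
/- Every cubic (3-regular) simple graph on 8 vertices has fair coalition number equal to 5, 6, or 8. -/
open SimpleGraph

namespace FairCub

/-- Table of the numbers of ones of all bytes (two bits per entry, capped at three). -/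
def popTab : Nat := 13407807929942597099574024998205846127439963814395998898509146416585202175328921868118355831529298524459806211834337169743732716546522497030730915424889236

def pop (m : Nat) : Nat := Nat.land (Nat.shiftRight popTab (Nat.mul 2 m)) 3

def rowOk (m b D k : Nat) : Bool :=
  match Nat.beq (Nat.land D b) 0 with
  | false => true
  | true => Nat.beq (pop (Nat.land m D)) k

/-- A graph on eight vertices: adjacency masks. -/
structure Rows where
  (r0 r1 r2 r3 r4 r5 r6 r7 : Nat)

def fairK (g : Rows) (D k : Nat) : Bool :=
  rowOk g.r0 1 D k && (rowOk g.r1 2 D k && (rowOk g.r2 4 D k && (rowOk g.r3 8 D k &&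
    (rowOk g.r4 16 D k && (rowOk g.r5 32 D k && (rowOk g.r6 64 D k && rowOk g.r7 128 D k))))))

def fairB (g : Rows) (D : Nat) : Bool := fairK g D 1 || (fairK g D 2 || fairK g D 3)

def singles : List Nat := [1, 2, 4, 8, 16, 32, 64, 128]

def pairs : List Nat := [3, 5, 9, 17, 33, 65, 129]

def cand1 : List Nat := [13, 21, 25, 37, 41, 49, 69, 73, 81, 97, 133, 137, 145, 161, 193]

def cand2 : List Nat := [11, 19, 25, 35, 41, 49, 67, 73, 81, 97, 131, 137, 145, 161, 193]

def cand3 : List Nat := [7, 19, 21, 35, 37, 49, 67, 69, 81, 97, 131, 133, 145, 161, 193]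

def cand4 : List Nat := [14, 38, 42, 44, 70, 74, 76, 98, 100, 104, 134, 138, 140, 162, 164, 168, 194, 196, 200, 224]

def cand5 : List Nat := [14, 22, 26, 28, 70, 74, 76, 82, 84, 88, 134, 138, 140, 146, 148, 152, 194, 196, 200, 208]

def cand6 : List Nat := [14, 22, 26, 28, 38, 42, 44, 50, 52, 56, 134, 138, 140, 146, 148, 152, 162, 164, 168, 176]

def cand7 : List Nat := [14, 22, 26, 28, 38, 42, 44, 50, 52, 56, 70, 74, 76, 82, 84, 88, 98, 100, 104, 112]

def pats : List (List Nat) := [[2, 4, 8, 49, 64, 128], [2, 4, 8, 16, 32, 193], [1, 24, 36, 66, 128], [1, 20, 40, 64, 130], [1, 18, 32, 72, 132], [1, 16, 34, 68, 136], [2, 4, 8, 32, 81, 128], [2, 4, 8, 32, 64, 145], [2, 4, 8, 16, 97, 128], [3, 4, 8, 96, 144], [2, 4, 8, 16, 64, 161], [3, 4, 8, 80, 160], [2, 5, 8, 48, 192], [1, 24, 32, 68, 130], [1, 16, 40, 66, 132], [1, 20, 34, 72, 128], [1, 18, 36, 64, 136], [1, 24, 34, 64, 132], [1, 18, 40, 68,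 128], [1, 16, 36, 72, 130], [1, 20, 32, 66, 136]]

def goodPat (g : Rows) (p : List Nat) : Bool :=
  p.all fun a => !(fairB g a) && p.any fun b => !(Nat.beq b a) && (!(fairB g b) && fairB g (Nat.lor a b))

def sevenAt (g : Rows) (ab : Nat) : Bool :=
  singles.any (fun c => Nat.beq (Nat.land c ab) 0 && fairB g (Nat.lor ab c)) &&
  (!(fairB g ab) && 
  singles.all (fun x => !(Nat.beq (Nat.land x ab) 0) || (fairB g x || (fairB g (Nat.lor ab x) ||
    singles.any fun y => Nat.beq (Nat.land y ab) 0 && (!(Nat.beq y x) && fairB g (Nat.lor x y))))))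

def leaf (g : Rows) : Bool := pats.any (goodPat g) && pairs.all fun ab => !(sevenAt g ab)

def bitAt (m i : Nat) : Nat := Nat.land (Nat.shiftRight m i) 1

/-- Rows `mi` and `mj` of the vertices `i` and `j` agree about the edge `ij`. -/
def agree (i mi j mj : Nat) : Bool := Nat.beq (bitAt mi j) (bitAt mj i)



def searchAll : Bool :=
  cand1.all fun m1 =>
  cand2.all fun m2 => !(agree 1 m1 2 m2) ||
  cand3.all fun m3 => !(agree 1 m1 3 m3 && (agree 2 m2 3 m3)) ||
  cand4.all fun m4 => !(agree 1 m1 4 m4 && (agree 2 m2 4 m4 && (agree 3 m3 4 m4))) ||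
  cand5.all fun m5 => !(agree 1 m1 5 m5 && (agree 2 m2 5 m5 && (agree 3 m3 5 m5 && (agree 4 m4 5 m5)))) ||
  cand6.all fun m6 => !(agree 1 m1 6 m6 && (agree 2 m2 6 m6 && (agree 3 m3 6 m6 && (agree 4 m4 6 m6 && (agree 5 m5 6 m6))))) ||
  cand7.all fun m7 => !(agree 1 m1 7 m7 && (agree 2 m2 7 m7 && (agree 3 m3 7 m7 && (agree 4 m4 7 m7 && (agree 5 m5 7 m7 && (agree 6 m6 7 m7)))))) ||
  leaf ⟨14, m1, m2, m3, m4, m5, m6, m7⟩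

set_option maxRecDepth 100000 in
theorem searchAll_true : searchAll = true := by decide +kernel

/-- The number of ones among the lowest eight bits of `m`, as a finset of positions. -/
def bits (m : Nat) : Finset (Fin 8) := Finset.univ.filter fun i => m.testBit i = true

theorem pop_eq : ∀ m < 256, (bits m).card ≤ 3 → pop m = (bits m).card := by decide +kernel

/-- The rows of a graph given as a function of the vertex. -/
def toRows (r : Fin 8 → Nat) : Rows := ⟨r 0, r 1, r 2, r 3, r 4, r 5, r 6, r 7⟩

theorem fairK_iff (r : Fin 8 → Nat) (D k : Nat) :
    fairK (toRows r) D k = true ↔ ∀ i : Fin 8, rowOk (r i) (2 ^ (i : ℕ)) D k = true := by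
  simp only [fairK, toRows, Bool.and_eq_true]
  constructor
  · rintro ⟨h0, h1, h2, h3, h4, h5, h6, h7⟩ i
    fin_cases i <;> assumption
  · intro h
    exact ⟨h 0, h 1, h 2, h 3, h 4, h 5, h 6, h 7⟩

theorem rowOk_iff (m D k : Nat) (i : ℕ) :
    rowOk m (2 ^ i) D k = true ↔ (D.testBit i = false → pop (m &&& D) = k) := by
  have h1 : Nat.beq (Nat.land D (2 ^ i)) 0 = !(D.testBit i) := by
    change Nat.beq (D &&& 2 ^ i) 0 = _
    rw [Nat.and_two_pow]
    have : 2 ^ i ≠ 0 := by positivity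
    cases D.testBit i
    · simp
    · rw [Bool.not_true, ← Bool.not_eq_true]
      simp
  unfold rowOk
  rw [h1]
  cases D.testBit i
  · change Nat.beq _ _ = true ↔ _
    rw [Nat.beq_eq]
    exact ⟨fun h _ => h, fun h => h rfl⟩
  · simp

theorem bitAt_eq (m i : Nat) : bitAt m i = (m.testBit i).toNat := by
  rw [Nat.toNat_testBit]
  change (m >>> i) &&& 1 = _
  rw [Nat.and_one_is_mod, Nat.shiftRight_eq_div_pow]

theorem mem_cand (i : Nat) (c : List Nat) (b : Bool)
    (hd : ∀ m < 256, ((bits m).card = 3 ∧ m.testBit i = false ∧ m.testBit 0 = b) → m ∈ c)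
    (m : Nat) (h0 : m < 256) (h1 : (bits m).card = 3) (h2 : m.testBit i = false)
    (h3 : m.testBit 0 = b) : m ∈ c := hd m h0 ⟨h1, h2, h3⟩

theorem leaf_true (r : Fin 8 → Nat) (hlt : ∀ i, r i < 256) (hc : ∀ i, (bits (r i)).card = 3)
    (hl : ∀ i : Fin 8, (r i).testBit i = false)
    (hs : ∀ i j : Fin 8, (r i).testBit j = (r j).testBit i) (h0 : r 0 = 14) :
    leaf (toRows r) = true := by
  have hag : ∀ i j : Fin 8, agree i (r i) j (r j) = true := by
    intro i j
    simp [agree, bitAt_eq, hs i j]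
  have hz : ∀ i : Fin 8, (r i).testBit 0 = (14 : ℕ).testBit i := by
    intro i
    have := hs i 0
    rw [h0] at this
    exact this
  have c1 : r 1 ∈ cand1 := mem_cand 1 cand1 true (by decide +kernel) _ (hlt 1) (hc 1) (hl 1) (hz 1)
  have c2 : r 2 ∈ cand2 := mem_cand 2 cand2 true (by decide +kernel) _ (hlt 2) (hc 2) (hl 2) (hz 2)
  have c3 : r 3 ∈ cand3 := mem_cand 3 cand3 true (by decide +kernel) _ (hlt 3) (hc 3) (hl 3) (hz 3)
  have c4 : r 4 ∈ cand4 := mem_cand 4 cand4 false (by decide +kernel) _ (hlt 4) (hc 4) (hl 4) (hz 4)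
  have c5 : r 5 ∈ cand5 := mem_cand 5 cand5 false (by decide +kernel) _ (hlt 5) (hc 5) (hl 5) (hz 5)
  have c6 : r 6 ∈ cand6 := mem_cand 6 cand6 false (by decide +kernel) _ (hlt 6) (hc 6) (hl 6) (hz 6)
  have c7 : r 7 ∈ cand7 := mem_cand 7 cand7 false (by decide +kernel) _ (hlt 7) (hc 7) (hl 7) (hz 7)
  have strip : ∀ b c : Bool, b = true → ((!b) || c) = true → c = true := by decide
  have conj : ∀ b c : Bool, b = true → c = true → (b && c) = true := by decide
  have s1 := List.all_eq_true.mp searchAll_true _ c1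
  have s2 := strip _ _ (hag 1 2) (List.all_eq_true.mp s1 _ c2)
  have s3 := strip _ _ (conj _ _ (hag 1 3) (hag 2 3)) (List.all_eq_true.mp s2 _ c3)
  have s4 := strip _ _ (conj _ _ (hag 1 4) (conj _ _ (hag 2 4) (hag 3 4)))
    (List.all_eq_true.mp s3 _ c4)
  have s5 := strip _ _ (conj _ _ (hag 1 5) (conj _ _ (hag 2 5) (conj _ _ (hag 3 5) (hag 4 5))))
    (List.all_eq_true.mp s4 _ c5)
  have s6 := strip _ _ (conj _ _ (hag 1 6) (conj _ _ (hag 2 6) (conj _ _ (hag 3 6)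
    (conj _ _ (hag 4 6) (hag 5 6))))) (List.all_eq_true.mp s5 _ c6)
  have s7 := strip _ _ (conj _ _ (hag 1 7) (conj _ _ (hag 2 7) (conj _ _ (hag 3 7)
    (conj _ _ (hag 4 7) (conj _ _ (hag 5 7) (hag 6 7)))))) (List.all_eq_true.mp s6 _ c7)
  unfold toRows
  rw [h0]
  exact s7

section
variable {V : Type*} (G : SimpleGraph V) (e : V ≃ Fin 8)

/-- The vertex set with mask `D`. -/
def S (D : Nat) : Set V := {v | D.testBit (e v) = true}

open Classical in
/-- The adjacency masks of `G`. -/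
noncomputable def row (i : Fin 8) : Nat :=
  Nat.ofBits fun j : Fin 8 => decide (G.Adj (e.symm i) (e.symm j))

theorem row_lt (i : Fin 8) : row G e i < 256 := Nat.ofBits_lt_two_pow _

theorem row_testBit (i j : Fin 8) :
    (row G e i).testBit j = true ↔ G.Adj (e.symm i) (e.symm j) := by
  classical
  unfold row
  rw [Nat.testBit_ofBits_lt _ _ j.2]
  simp

theorem card_inter (D : Nat) (v : V) :
    (G.neighborSet v ∩ S e D).ncard = (bits (row G e (e v) &&& D)).card := by
  rw [← Set.ncard_image_of_injective _ e.injective, ← Set.ncard_coe_finset]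
  congr 1
  ext i
  simp only [Set.mem_image, Set.mem_inter_iff, mem_neighborSet, S, Set.mem_ofPred_eq, bits,
    Finset.coe_filter, Finset.mem_univ, true_and, Nat.testBit_and, Bool.and_eq_true, row_testBit]
  constructor
  · rintro ⟨u, ⟨h1, h2⟩, rfl⟩
    simpa using ⟨h1, h2⟩
  · rintro ⟨h1, h2⟩
    rw [Equiv.symm_apply_apply] at h1
    exact ⟨e.symm i, ⟨h1, by simpa using h2⟩, by simp⟩

theorem card_row (hG : ∀ v, (G.neighborSet v).ncard = 3) (i : Fin 8) :
    (bits (row G e i)).card = 3 := by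
  rw [← hG (e.symm i), ← Set.ncard_image_of_injective _ e.injective, ← Set.ncard_coe_finset]
  congr 1
  ext j
  simp only [bits, row_testBit, Finset.coe_filter, Finset.mem_univ, true_and, Set.mem_ofPred_eq,
    Set.mem_image, mem_neighborSet]
  constructor
  · intro h
    exact ⟨_, h, by simp⟩
  · rintro ⟨u, h, rfl⟩
    simpa using h

theorem fair_iff (hG : ∀ v, (G.neighborSet v).ncard = 3) (D : Nat) :
    fairB (toRows (row G e)) D = true ↔ IsFairDomSet G (S e D) := by
  have hpop : ∀ v, pop (row G e (e v) &&& D) = (G.neighborSet v ∩ S e D).ncard := by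
    intro v
    rw [card_inter]
    apply pop_eq
    · exact lt_of_le_of_lt Nat.and_le_left (row_lt G e _)
    · rw [← card_row G e hG (e v)]
      apply Finset.card_le_card
      intro i
      simp only [bits, Finset.mem_filter, Finset.mem_univ, true_and, Nat.testBit_and,
        Bool.and_eq_true]
      exact fun h => h.1
  have hle : ∀ v, (G.neighborSet v ∩ S e D).ncard ≤ 3 := by
    intro v
    rw [← hG v]
    exact Set.ncard_le_ncard Set.inter_subset_left (Set.finite_of_ncard_ne_zero (by rw [hG]; simp))
  have hK : ∀ k, fairK (toRows (row G e)) D k = true ↔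
      ∀ v ∉ S e D, (G.neighborSet v ∩ S e D).ncard = k := by
    intro k
    rw [fairK_iff]
    simp only [rowOk_iff]
    constructor
    · intro h v hv
      rw [← hpop]
      exact h (e v) (by simpa [S] using hv)
    · intro h i hi
      have := h (e.symm i) (by simpa [S] using hi)
      rw [← hpop] at this
      simpa using this
  unfold fairB IsFairDomSet
  simp only [Bool.or_eq_true, hK]
  constructor
  · intro h
    have : ∃ k : ℕ, 1 ≤ k ∧ ∀ v ∉ S e D, (G.neighborSet v ∩ S e D).ncard = k := by
      rcases h with h | h | h
      · exact ⟨1, by norm_num, h⟩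
      · exact ⟨2, by norm_num, h⟩
      · exact ⟨3, by norm_num, h⟩
    refine ⟨?_, this⟩
    obtain ⟨k, hk, h⟩ := this
    intro v hv
    have h1 := h v hv
    obtain ⟨u, hu⟩ := Set.nonempty_of_ncard_ne_zero (s := G.neighborSet v ∩ S e D) (by omega)
    exact ⟨u, hu.2, hu.1⟩
  · rintro ⟨_, k, hk, h⟩
    by_cases hne : ∃ v, v ∉ S e D
    · obtain ⟨v, hv⟩ := hne
      have h1 := h v hv
      have h2 := hle v
      have : k = 1 ∨ k = 2 ∨ k = 3 := by omega
      rcases this with rfl | rfl | rfl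
      · exact Or.inl h
      · exact Or.inr (Or.inl h)
      · exact Or.inr (Or.inr h)
    · left
      intro v hv
      exact absurd ⟨v, hv⟩ hne

theorem S_lor (a b : Nat) : S e (Nat.lor a b) = S e a ∪ S e b := by
  ext v
  change (a ||| b).testBit _ = true ↔ _
  simp [S, Nat.testBit_or]

theorem S_pow (v : V) : S e (2 ^ (e v : ℕ)) = {v} := by
  ext u
  simp only [S, Set.mem_ofPred_eq, Nat.testBit_two_pow, decide_eq_true_eq, Set.mem_singleton_iff]
  rw [← Fin.ext_iff, e.injective.eq_iff, eq_comm]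

theorem leaf_row (hG : ∀ v, (G.neighborSet v).ncard = 3)
    (h0 : ∀ i : Fin 8, G.Adj (e.symm 0) (e.symm i) ↔ (14 : ℕ).testBit i = true) :
    leaf (toRows (row G e)) = true := by
  apply leaf_true
  · exact row_lt G e
  · exact card_row G e hG
  · intro i
    rw [← Bool.not_eq_true, row_testBit]
    exact G.loopless.irrefl _
  · intro i j
    rw [Bool.eq_iff_iff, row_testBit, row_testBit, G.adj_comm]
  · apply Nat.eq_of_testBit_eq
    intro i
    by_cases hi : i < 8
    · rw [Bool.eq_iff_iff]
      have := row_testBit G e 0 ⟨i, hi⟩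
      rw [h0] at this
      exact this
    · rw [Nat.testBit_lt_two_pow, Nat.testBit_lt_two_pow]
      · have h2 : 2 ^ 8 ≤ 2 ^ i := Nat.pow_le_pow_right (by norm_num) (by omega)
        omega
      · have h2 : 2 ^ 8 ≤ 2 ^ i := Nat.pow_le_pow_right (by norm_num) (by omega)
        have := row_lt G e 0
        omega

theorem pats_ok : ∀ p ∈ pats, (∀ a ∈ p, ∃ i : Fin 8, a.testBit i = true) ∧
    (∀ a ∈ p, ∀ b ∈ p, a ≠ b → ∀ i : Fin 8, ¬ (a.testBit i = true ∧ b.testBit i = true)) ∧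
    (∀ i : Fin 8, ∃ a ∈ p, a.testBit i = true) ∧ p.Nodup ∧ 5 ≤ p.length := by decide +kernel

theorem exists_big (hG : ∀ v, (G.neighborSet v).ncard = 3)
    (h0 : ∀ i : Fin 8, G.Adj (e.symm 0) (e.symm i) ↔ (14 : ℕ).testBit i = true) :
    ∃ P : Finset (Set V), IsFairCoalitionPartition G P ∧ 5 ≤ P.card := by
  classical
  have hl := leaf_row G e hG h0
  unfold leaf at hl
  rw [Bool.and_eq_true, List.any_eq_true] at hl
  obtain ⟨⟨p, hp, hgood⟩, -⟩ := hl
  obtain ⟨q1, q2, q3, q4, q5⟩ := pats_ok p hp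
  have hdisj : ∀ a ∈ p, ∀ b ∈ p, a ≠ b → Disjoint (S e a) (S e b) := by
    intro a ha b hb hab
    rw [Set.disjoint_left]
    intro v hv hv'
    exact q2 a ha b hb hab (e v) ⟨hv, hv'⟩
  have hne : ∀ a ∈ p, (S e a).Nonempty := by
    intro a ha
    obtain ⟨i, hi⟩ := q1 a ha
    exact ⟨e.symm i, by simpa [S] using hi⟩
  have hinj : ∀ a ∈ p, ∀ b ∈ p, S e a = S e b → a = b := by
    intro a ha b hb hab
    by_contra hn
    have := hdisj a ha b hb hn
    rw [hab, disjoint_self] at this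
    exact (hne b hb).ne_empty this
  refine ⟨(p.map (S e)).toFinset, ⟨?_, ?_, ?_, ?_⟩, ?_⟩
  · intro A hA
    simp only [List.mem_toFinset, List.mem_map] at hA
    obtain ⟨a, ha, rfl⟩ := hA
    exact hne a ha
  · intro A hA B hB hAB
    simp only [List.coe_toFinset, List.mem_map, Set.mem_ofPred_eq] at hA hB
    obtain ⟨a, ha, rfl⟩ := hA
    obtain ⟨b, hb, rfl⟩ := hB
    exact hdisj a ha b hb (fun h => hAB (by rw [h]))
  · ext v
    simp only [Set.mem_sUnion, List.coe_toFinset, List.mem_map, Set.mem_ofPred_eq, Set.mem_univ,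
      iff_true]
    obtain ⟨a, ha, h⟩ := q3 (e v)
    exact ⟨_, ⟨a, ha, rfl⟩, h⟩
  · intro A hA
    simp only [List.mem_toFinset, List.mem_map] at hA
    obtain ⟨a, ha, rfl⟩ := hA
    have h1 := List.all_eq_true.mp hgood a ha
    rw [Bool.and_eq_true, List.any_eq_true] at h1
    obtain ⟨h1, b, hb, h2⟩ := h1
    rw [Bool.and_eq_true, Bool.and_eq_true] at h2
    obtain ⟨h2, h3, h4⟩ := h2
    rw [Bool.not_eq_true', ← Bool.not_eq_true, fair_iff G e hG] at h1 h3
    rw [fair_iff G e hG, S_lor] at h4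
    refine Or.inr ⟨h1, S e b, ?_, ?_, h3, h4⟩
    · simp only [List.mem_toFinset, List.mem_map]
      exact ⟨b, hb, rfl⟩
    · intro h
      have := hinj b hb a ha h
      simp [this] at h2
  · rw [List.toFinset_card_of_nodup]
    · simpa using q5
    · exact List.Nodup.map_on (fun a ha b hb h => hinj a ha b hb h) q4

theorem single_mem : ∀ i : Fin 8, 2 ^ (i : ℕ) ∈ singles := by decide

theorem singles_eq : ∀ x ∈ singles, ∃ i : Fin 8, x = 2 ^ (i : ℕ) := by decide

theorem pair_mem : ∀ i : Fin 8, i ≠ 0 → Nat.lor (2 ^ ((0 : Fin 8) : ℕ)) (2 ^ (i : ℕ)) ∈ pairs := by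
  decide

theorem land_zero (D : Nat) (v : V) :
    Nat.beq (Nat.land (2 ^ (e v : ℕ)) D) 0 = true ↔ v ∉ S e D := by
  change Nat.beq (2 ^ (e v : ℕ) &&& D) 0 = true ↔ ¬ (D.testBit _ = true)
  rw [Nat.and_comm, Nat.and_two_pow]
  cases D.testBit (e v)
  · simp
  · simp

theorem no_seven (hG : ∀ v, (G.neighborSet v).ncard = 3)
    (h0 : ∀ i : Fin 8, G.Adj (e.symm 0) (e.symm i) ↔ (14 : ℕ).testBit i = true)
    (a b : V) (hab : a ≠ b) (ha : e a = 0)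
    (P : Finset (Set V)) (hP : IsFairCoalitionPartition G P) (hA : ({a, b} : Set V) ∈ P)
    (hs : ∀ A ∈ P, A = {a, b} ∨ ∃ x, x ≠ a ∧ x ≠ b ∧ A = {x})
    (hx : ∀ x, x ≠ a → x ≠ b → ({x} : Set V) ∈ P) : False := by
  have hl := leaf_row G e hG h0
  unfold leaf at hl
  rw [Bool.and_eq_true, List.all_eq_true] at hl
  have hb0 : e b ≠ 0 := by
    rw [← ha]
    exact fun h => hab (e.injective h).symm
  have h7 := hl.2 _ (pair_mem (e b) hb0)
  have hS : S e (Nat.lor (2 ^ ((0 : Fin 8) : ℕ)) (2 ^ (e b : ℕ))) = {a, b} := by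
    rw [S_lor, ← ha, S_pow, S_pow]
    rfl
  generalize Nat.lor (2 ^ ((0 : Fin 8) : ℕ)) (2 ^ (e b : ℕ)) = D at h7 hS
  obtain ⟨-, -, -, hc⟩ := hP
  have hAA : ¬ IsFairDomSet G ({a, b} : Set V) ∧ ∃ B ∈ P, B ≠ {a, b} ∧ ¬ IsFairDomSet G B ∧
      IsFairDomSet G ({a, b} ∪ B) := by
    rcases hc _ hA with ⟨⟨v, hv⟩, -⟩ | h
    · exfalso
      have h1 : a ∈ ({v} : Set V) := hv ▸ Set.mem_insert a _
      have h2 : b ∈ ({v} : Set V) := hv ▸ Set.mem_insert_of_mem a rfl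
      exact hab (h1.trans h2.symm)
    · exact h
  have notin : ∀ x, x ≠ a → x ≠ b → x ∉ S e D := by
    intro x h1 h2
    rw [hS]
    simp [h1, h2]
  suffices h : sevenAt (toRows (row G e)) D = true by
    rw [h] at h7
    exact absurd h7 (by decide)
  unfold sevenAt
  rw [Bool.and_eq_true, Bool.and_eq_true, List.any_eq_true, List.all_eq_true]
  refine ⟨?_, ?_, ?_⟩
  · obtain ⟨-, B, hB, hBne, -, hf⟩ := hAA
    rcases hs B hB with h | ⟨x, hxa, hxb, rfl⟩
    · exact absurd h hBne
    · refine ⟨2 ^ (e x : ℕ), single_mem _, ?_⟩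
      rw [Bool.and_eq_true, land_zero, fair_iff G e hG, S_lor, hS, S_pow]
      exact ⟨by rw [← hS]; exact notin x hxa hxb, hf⟩
  · rw [Bool.not_eq_true', ← Bool.not_eq_true, fair_iff G e hG, hS]
    exact hAA.1
  · intro m hm
    obtain ⟨i, rfl⟩ := singles_eq m hm
    obtain ⟨x, rfl⟩ := e.surjective i
    rw [Bool.or_eq_true, Bool.or_eq_true, Bool.or_eq_true, List.any_eq_true,
      Bool.not_eq_true', ← Bool.not_eq_true, land_zero, not_not,
      fair_iff G e hG, fair_iff G e hG, S_lor, S_pow]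
    by_cases hxin : x ∈ S e D
    · exact Or.inl hxin
    right
    have hxa : x ≠ a := by rintro rfl; exact hxin (by rw [hS]; simp)
    have hxb : x ≠ b := by rintro rfl; exact hxin (by rw [hS]; simp)
    rcases hc _ (hx x hxa hxb) with ⟨-, hf⟩ | ⟨-, B, hB, hBne, -, hf⟩
    · exact Or.inl hf
    right
    rcases hs B hB with rfl | ⟨y, hya, hyb, rfl⟩
    · left
      rw [hS, Set.union_comm]
      exact hf
    · right
      refine ⟨2 ^ (e y : ℕ), single_mem _, ?_⟩
      rw [Bool.and_eq_true, Bool.and_eq_true, land_zero, fair_iff G e hG, S_lor, S_pow, S_pow]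
      refine ⟨notin y hya hyb, ?_, hf⟩
      rw [Bool.not_eq_true', ← Bool.not_eq_true, Nat.beq_eq]
      intro h
      have h2 : (e y : ℕ) = (e x : ℕ) := Nat.pow_right_injective (le_refl 2) h
      have := e.injective (Fin.ext h2)
      exact hBne (by rw [this])

end

theorem exists_equiv {V : Type*} [Fintype V] (G : SimpleGraph V)
    (hcard : Fintype.card V = 8) (hG : ∀ v, (G.neighborSet v).ncard = 3) (a : V) :
    ∃ e : V ≃ Fin 8, e a = 0 ∧
      ∀ i : Fin 8, G.Adj (e.symm 0) (e.symm i) ↔ (14 : ℕ).testBit i = true := by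
  classical
  let f : V → Fin 3 := fun v => if v = a then 0 else if G.Adj a v then 1 else 2
  let g : Fin 8 → Fin 3 := fun i => if i = 0 then 0 else if (14 : ℕ).testBit i = true then 1 else 2
  have k0 : Fintype.card {v // f v = 0} = 1 := by
    rw [Fintype.card_eq_one_iff]
    refine ⟨⟨a, by simp [f]⟩, ?_⟩
    rintro ⟨v, hv⟩
    by_contra hne
    have : v ≠ a := fun h => hne (by simp [h])
    simp only [f, this, if_false] at hv
    split_ifs at hv <;> simp at hv
  have k1 : Fintype.card {v // f v = 1} = 3 := by
    refine Eq.trans ?_ (hG a)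
    rw [← Nat.card_coe_set_eq, ← Nat.card_eq_fintype_card]
    apply Nat.card_congr
    apply Equiv.subtypeEquivRight
    intro v
    by_cases h : v = a
    · simp [f, h]
    · by_cases h' : G.Adj a v <;> simp [f, h, h']
  have ksum : ∑ c : Fin 3, Fintype.card {v // f v = c} = 8 := by
    rw [← Fintype.card_sigma, ← hcard]
    exact Fintype.card_congr (Equiv.sigmaFiberEquiv f)
  rw [Fin.sum_univ_three, k0, k1] at ksum
  have kg : ∀ c, Fintype.card {v // f v = c} = Fintype.card {i // g i = c} := by
    have g0 : Fintype.card {i // g i = 0} = 1 := by decide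
    have g1 : Fintype.card {i // g i = 1} = 3 := by decide
    have g2 : Fintype.card {i // g i = 2} = 4 := by decide
    intro c
    fin_cases c
    · exact k0.trans g0.symm
    · exact k1.trans g1.symm
    · refine Eq.trans ?_ g2.symm
      change Fintype.card {v // f v = 2} = 4
      omega
  let e : V ≃ Fin 8 := Equiv.ofFiberEquiv fun c => Fintype.equivOfCardEq (kg c)
  have he : ∀ v, g (e v) = f v := fun v => Equiv.ofFiberEquiv_map _ v
  have gz : ∀ i, g i = 0 → i = 0 := by decide
  have g1 : ∀ i, g i = 1 ↔ (14 : ℕ).testBit i = true := by decide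
  have ha : e a = 0 := gz _ (by rw [he]; simp [f])
  refine ⟨e, ha, ?_⟩
  intro i
  rw [← ha, Equiv.symm_apply_apply, ← g1, ← e.apply_symm_apply i, he, Equiv.symm_apply_apply]
  by_cases h : e.symm i = a
  · simp [f, h]
  · by_cases h' : G.Adj a (e.symm i) <;> simp [f, h, h']

theorem part_map {V : Type*} (G : SimpleGraph V) (P : Finset (Set V))
    (hP : IsFairCoalitionPartition G P) :
    ∃ f : V → P, Function.Surjective f ∧ ∀ v, ∀ A : P, v ∈ A.1 ↔ f v = A := by
  obtain ⟨h1, h2, h3, -⟩ := hP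
  have : ∀ v, ∃ A : P, v ∈ A.1 := by
    intro v
    have : v ∈ ⋃₀ (P : Set (Set V)) := by rw [h3]; trivial
    obtain ⟨A, hA, hv⟩ := this
    exact ⟨⟨A, hA⟩, hv⟩
  choose f hf using this
  have hiff : ∀ v, ∀ A : P, v ∈ A.1 ↔ f v = A := by
    intro v A
    constructor
    · intro hv
      by_contra hne
      have := h2 (f v).2 A.2 (fun h => hne (Subtype.ext h))
      exact Set.disjoint_left.mp this (hf v) hv
    · rintro rfl
      exact hf v
  refine ⟨f, ?_, hiff⟩
  intro A
  obtain ⟨v, hv⟩ := h1 A.1 A.2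
  exact ⟨v, (hiff v A).mp hv⟩

theorem not_seven {V : Type*} [Fintype V] (G : SimpleGraph V)
    (hcard : Fintype.card V = 8) (hG : ∀ v, (G.neighborSet v).ncard = 3)
    (P : Finset (Set V)) (hP : IsFairCoalitionPartition G P) : P.card ≠ 7 := by
  classical
  intro h7
  obtain ⟨f, hsurj, hiff⟩ := part_map G P hP
  have hcP : Fintype.card P = 7 := by simpa using h7
  obtain ⟨a, b, hab, hfab⟩ := Fintype.exists_ne_map_eq_of_card_lt f (by omega)
  let f' : {v // v ≠ b} → P := fun v => f v.1
  have hsurj' : Function.Surjective f' := by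
    intro A
    obtain ⟨v, hv⟩ := hsurj A
    by_cases h : v = b
    · exact ⟨⟨a, hab⟩, by change f a = A; rw [hfab, ← h, hv]⟩
    · exact ⟨⟨v, h⟩, hv⟩
  have hc' : Fintype.card {v // v ≠ b} = Fintype.card P := by
    rw [Fintype.card_subtype_compl, Fintype.card_subtype_eq, hcard, hcP]
  have hinj' : Function.Injective f' :=
    ((Fintype.bijective_iff_surjective_and_card f').mpr ⟨hsurj', hc'⟩).1
  have hinj : ∀ x y, x ≠ b → y ≠ b → f x = f y → x = y := by
    intro x y hx hy h
    exact congrArg Subtype.val (@hinj' ⟨x, hx⟩ ⟨y, hy⟩ h)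
  have hA : (f a).1 = {a, b} := by
    ext v
    rw [hiff]
    simp only [Set.mem_insert_iff, Set.mem_singleton_iff]
    constructor
    · intro h
      by_cases hv : v = b
      · exact Or.inr hv
      · exact Or.inl (hinj v a hv hab h)
    · rintro (rfl | rfl)
      · rfl
      · exact hfab.symm
  have hB : ∀ x, x ≠ a → x ≠ b → (f x).1 = {x} := by
    intro x hxa hxb
    ext v
    rw [hiff, Set.mem_singleton_iff]
    constructor
    · intro h
      by_cases hv : v = b
      · exfalso
        subst hv
        exact hxa (hinj x a hxb hab (by rw [hfab, h]))
      · exact hinj v x hv hxb h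
    · rintro rfl
      rfl
  obtain ⟨e, ha, h0⟩ := exists_equiv G hcard hG a
  refine no_seven G e hG h0 a b hab ha P hP (hA ▸ (f a).2) ?_ ?_
  · intro A hAP
    obtain ⟨x, hx⟩ := hsurj ⟨A, hAP⟩
    have hxA : (f x).1 = A := by rw [hx]
    by_cases hxa : x = a
    · left; rw [← hxA, hxa, hA]
    · by_cases hxb : x = b
      · left; rw [← hxA, hxb, ← hfab, hA]
      · exact Or.inr ⟨x, hxa, hxb, by rw [← hxA, hB x hxa hxb]⟩
  · intro x hxa hxb
    exact hB x hxa hxb ▸ (f x).2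

end FairCub

theorem stmt_15 {V : Type*} [Fintype V] (G : SimpleGraph V) [DecidableRel G.Adj]
    (hcard : Fintype.card V = 8) (hcubic : G.IsRegularOfDegree 3) :
    fairCoalitionNumber G = 5 ∨ fairCoalitionNumber G = 6 ∨ fairCoalitionNumber G = 8 := by
  have hG : ∀ v, (G.neighborSet v).ncard = 3 := by
    intro v
    rw [← hcubic v, ← SimpleGraph.card_neighborSet_eq_degree, ← Nat.card_coe_set_eq,
      Nat.card_eq_fintype_card]
  have hne : Nonempty V := Fintype.card_pos_iff.mp (by omega)
  obtain ⟨a⟩ := hne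
  obtain ⟨e, -, h0⟩ := FairCub.exists_equiv G hcard hG a
  obtain ⟨P, hP, h5⟩ := FairCub.exists_big G e hG h0
  have hub : ∀ n ∈ {n | ∃ P : Finset (Set V), IsFairCoalitionPartition G P ∧ P.card = n},
      n ≤ 8 := by
    rintro n ⟨Q, hQ, rfl⟩
    obtain ⟨f, hf, -⟩ := FairCub.part_map G Q hQ
    have := Fintype.card_le_of_surjective f hf
    rw [hcard] at this
    simpa using this
  have hbdd : BddAbove {n | ∃ P : Finset (Set V), IsFairCoalitionPartition G P ∧ P.card = n} :=
    ⟨8, hub⟩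
  have hnon : {n | ∃ P : Finset (Set V),
      IsFairCoalitionPartition G P ∧ P.card = n}.Nonempty := ⟨_, P, hP, rfl⟩
  have hmem := Nat.sSup_mem hnon hbdd
  have hge := le_csSup hbdd (a := P.card) ⟨P, hP, rfl⟩
  have hle := hub _ hmem
  obtain ⟨Q, hQ, hQc⟩ := hmem
  have h7 := FairCub.not_seven G hcard hG Q hQ
  change fairCoalitionNumber G ≤ 8 at hle
  change _ ≤ fairCoalitionNumber G at hge
  change _ = fairCoalitionNumber G at hQc
  omega
end
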